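/- arXiv:1712.00896 — 2 statements merged into one kernel-verified Lean document; each statement's English description precedes it below -/
import Mathlib

section
/- For every b ∈ ℂ and every n ∈ ℤ², as operators on N: Θ_b(E21(n)) = E21(n), and Θ_b(E12(n)) = E12(n) + b(q^{m₂n₁}E22(m+n) − q^{m₁n₂}E11(m+n))∘X_m^{−1} − b(b−1)q^{m₂n₁+m₂m₁+m₁n₂} X_{2m+n}∘X_m^{−2}. -/
open MvPolynomial Finsupp

/-- The index set of the variables other than `x_m`. -/
abbrev NVar (m : ℤ × ℤ) := {p : ℤ × ℤ // p ≠ m}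

/-- `N = ℂ[x_m, x_m^{−1}][x_n : n ≠ m]`, realized as finitely supported families,
indexed by the exponent of `x_m` (an arbitrary integer), of polynomials in the
variables `x_n`, `n ≠ m`. -/
abbrev NN (m : ℤ × ℤ) := ℤ →₀ MvPolynomial (NVar m) ℂ

/-- Multiplication by `x_m^j` on `N` (for `j = -1` this is `X_m^{−1}`). -/
noncomputable def XmZ (m : ℤ × ℤ) (j : ℤ) (g : NN m) : NN m :=
  Finsupp.mapDomain (· + j) g

/-- Multiplication by `x_k` on `N` (the operator `X_k`). -/
noncomputable def Xop (m : ℤ × ℤ) (k : ℤ × ℤ) (g : NN m) : NN m :=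
  if h : k = m then XmZ m 1 g
  else Finsupp.mapRange (fun a => X (⟨k, h⟩ : NVar m) * a) (by simp) g

/-- The partial derivative `∂_s` on `N` (with `∂_m x_m^k = k x_m^{k−1}`, `k ∈ ℤ`). -/
noncomputable def Dop (m : ℤ × ℤ) (s : ℤ × ℤ) (g : NN m) : NN m :=
  if h : s = m then g.sum (fun k a => Finsupp.single (k - 1) (k • a))
  else Finsupp.mapRange (fun a => pderiv (⟨s, h⟩ : NVar m) a) (by simp) g

/-- A finite set of indices containing every `s` for which `∂_s` acts nonzero on `g`
(together with `m`); sums over all `s ∈ ℤ²` in the defining formulas reduce to sums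
over this finite set. -/
noncomputable def nvars (m : ℤ × ℤ) (g : NN m) : Finset (ℤ × ℤ) :=
  insert m (g.support.biUnion fun k => (g k).vars.image Subtype.val)

/-- `E21(n)` on `N`: multiplication by `x_n`. -/
noncomputable def E21N (m n : ℤ × ℤ) (g : NN m) : NN m := Xop m n g

/-- `E22(n) = Σ_s q^{s₁n₂} x_{n+s} ∂_s` on `N`. -/
noncomputable def E22N (q : ℂ) (m n : ℤ × ℤ) (g : NN m) : NN m :=
  ∑ s ∈ nvars m g, q ^ (s.1 * n.2) • Xop m (n + s) (Dop m s g)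

/-- `E11(n) = δ_{n,0} μ id − Σ_s q^{s₂n₁} x_{n+s} ∂_s` on `N`. -/
noncomputable def E11N (q μ : ℂ) (m n : ℤ × ℤ) (g : NN m) : NN m :=
  (if n = 0 then μ • g else 0) - ∑ s ∈ nvars m g, q ^ (s.2 * n.1) • Xop m (n + s) (Dop m s g)

/-- `E12(n) = q^{−n₁n₂} μ ∂_{−n} − Σ_{s,r} q^{n₂r₁+s₂n₁+s₂r₁} x_{n+s+r} ∂_s ∂_r` on `N`. -/
noncomputable def E12N (q μ : ℂ) (m n : ℤ × ℤ) (g : NN m) : NN m :=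
  q ^ (-(n.1 * n.2)) • μ • Dop m (-n) g -
    ∑ s ∈ nvars m g, ∑ r ∈ nvars m g,
      q ^ (n.2 * r.1 + s.2 * n.1 + s.2 * r.1) • Xop m (n + s + r) (Dop m s (Dop m r g))

/-- `𝓔_m = Σ_{s,r} q^{−m₂r₁−s₂m₁+s₂r₁} x_{−m+s+r} ∂_s ∂_r` on `N`. -/
noncomputable def EmN (q : ℂ) (m : ℤ × ℤ) (g : NN m) : NN m :=
  ∑ s ∈ nvars m g, ∑ r ∈ nvars m g,
    q ^ (-(m.2 * r.1) - s.2 * m.1 + s.2 * r.1) • Xop m (-m + s + r) (Dop m s (Dop m r g))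

/-- `D1 = Σ_s s₁ x_s ∂_s` on `N`. -/
noncomputable def D1N (m : ℤ × ℤ) (g : NN m) : NN m :=
  ∑ s ∈ nvars m g, (s.1 : ℂ) • Xop m s (Dop m s g)

/-- `D2 = Σ_s s₂ x_s ∂_s` on `N`. -/
noncomputable def D2N (m : ℤ × ℤ) (g : NN m) : NN m :=
  ∑ s ∈ nvars m g, (s.2 : ℂ) • Xop m s (Dop m s g)

/-- `ad(X_m) = [X_m, −]` acting on operators on `N`. -/
noncomputable def adXm (m : ℤ × ℤ) (A : NN m → NN m) : NN m → NN m :=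
  fun g => XmZ m 1 (A g) - A (XmZ m 1 g)

/-- The generalized binomial coefficient `C(b,j) = b(b−1)⋯(b−j+1)/j!`. -/
noncomputable def bchoose (b : ℂ) (j : ℕ) : ℂ :=
  (∏ i ∈ Finset.range j, (b - (i : ℂ))) / (j.factorial : ℂ)

/-- `Θ_b(u) = Σ_{j≥0} C(b,j) (ad X_m)^j(u) ∘ X_m^{−j}`; for `ad(X_m)`-nilpotent `u`
the family has finite support, so the `finsum` is the honest finite sum. -/
noncomputable def Theta (m : ℤ × ℤ) (b : ℂ) (u : NN m → NN m) : NN m → NN m :=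
  ∑ᶠ j : ℕ, bchoose b j • ((adXm m)^[j] u) ∘ (XmZ m (-1))^[j]

theorem XmZ_apply (m : ℤ × ℤ) (j : ℤ) (g : NN m) (i : ℤ) : XmZ m j g i = g (i - j) := by
  have h := Finsupp.mapDomain_apply (add_left_injective j) g (i - j)
  simpa [XmZ] using h

theorem Xop_self (m : ℤ × ℤ) (g : NN m) : Xop m m g = XmZ m 1 g := by
  simp [Xop]

theorem Xop_apply_of_ne {m k : ℤ × ℤ} (h : k ≠ m) (g : NN m) (i : ℤ) :
    Xop m k g i = X (⟨k, h⟩ : NVar m) * g i := by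
  simp [Xop, h]

theorem Dop_self_apply (m : ℤ × ℤ) (g : NN m) (i : ℤ) :
    Dop m m g i = (i + 1) • g (i + 1) := by
  simp only [Dop, dite_true, Finsupp.sum, Finsupp.finsetSum_apply, Finsupp.single_apply]
  rw [Finset.sum_eq_single (i + 1)]
  · simp
  · intro k _ hk
    exact if_neg fun h => hk (by omega)
  · intro h
    simp [Finsupp.notMem_support_iff.mp h]

theorem Dop_apply_of_ne {m s : ℤ × ℤ} (h : s ≠ m) (g : NN m) (i : ℤ) :
    Dop m s g i = pderiv (⟨s, h⟩ : NVar m) (g i) := by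
  simp [Dop, h]

/-- `XmZ` as a linear map. -/
noncomputable def XmZLin (m : ℤ × ℤ) (j : ℤ) : NN m →ₗ[ℂ] NN m where
  toFun := XmZ m j
  map_add' f g := by ext1 i; simp [XmZ_apply]
  map_smul' c g := by ext1 i; simp [XmZ_apply]

/-- `Xop` as a linear map. -/
noncomputable def XopLin (m k : ℤ × ℤ) : NN m →ₗ[ℂ] NN m where
  toFun := Xop m k
  map_add' f g := by
    by_cases h : k = m
    · subst h; rw [Xop_self, Xop_self, Xop_self]; exact map_add (XmZLin k 1) f g
    · ext1 i; simp [Xop_apply_of_ne h, mul_add]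
  map_smul' c g := by
    by_cases h : k = m
    · subst h; rw [Xop_self, Xop_self]; exact map_smul (XmZLin k 1) c g
    · ext1 i; simp [Xop_apply_of_ne h]

/-- `Dop` as a linear map. -/
noncomputable def DopLin (m s : ℤ × ℤ) : NN m →ₗ[ℂ] NN m where
  toFun := Dop m s
  map_add' f g := by
    by_cases h : s = m
    · subst h; ext1 i; simp [Dop_self_apply, smul_add]
    · ext1 i; simp [Dop_apply_of_ne h]
  map_smul' c g := by
    by_cases h : s = m
    · subst h; ext1 i
      simp only [Dop_self_apply, Finsupp.smul_apply, RingHom.id_apply]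
      exact smul_comm _ _ _
    · ext1 i; simp [Dop_apply_of_ne h]

theorem XopLin_XmZLin (m k : ℤ × ℤ) (j : ℤ) (g : NN m) :
    XopLin m k (XmZLin m j g) = XmZLin m j (XopLin m k g) := by
  change Xop m k (XmZ m j g) = XmZ m j (Xop m k g)
  ext1 i
  by_cases h : k = m
  · subst h; simp only [Xop_self, XmZ_apply]; congr 1; ring
  · simp only [Xop_apply_of_ne h, XmZ_apply]

/-- The canonical commutation relation between `∂_s` and `X_m`. -/
theorem DopLin_XmZLin_one (m s : ℤ × ℤ) (g : NN m) :
    DopLin m s (XmZLin m 1 g) = XmZLin m 1 (DopLin m s g) + if s = m then g else 0 := by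
  change Dop m s (XmZ m 1 g) = XmZ m 1 (Dop m s g) + _
  ext1 i
  by_cases h : s = m
  · subst h
    simp [Dop_self_apply, XmZ_apply]
    ring
  · simp [Dop_apply_of_ne h, XmZ_apply, h]

theorem nvars_XmZ (m : ℤ × ℤ) (j : ℤ) (g : NN m) : nvars m (XmZ m j g) = nvars m g := by
  unfold nvars
  congr 1
  ext p
  simp only [Finset.mem_biUnion, Finsupp.mem_support_iff, XmZ_apply]
  constructor
  · rintro ⟨k, hk⟩
    exact ⟨k - j, hk⟩
  · rintro ⟨k, hk⟩
    exact ⟨k + j, by simpa using hk⟩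

theorem mem_nvars_self (m : ℤ × ℤ) (g : NN m) : m ∈ nvars m g :=
  Finset.mem_insert_self _ _

theorem E22N_eq (q : ℂ) (m n : ℤ × ℤ) (g : NN m) :
    E22N q m n g =
      ∑ s ∈ nvars m g, q ^ (s.1 * n.2) • XopLin m (n + s) (DopLin m s g) := rfl

theorem E11N_eq (q μ : ℂ) (m n : ℤ × ℤ) (g : NN m) :
    E11N q μ m n g = (if n = 0 then μ • g else 0) -
      ∑ s ∈ nvars m g, q ^ (s.2 * n.1) • XopLin m (n + s) (DopLin m s g) := rfl

theorem E12N_eq (q μ : ℂ) (m n : ℤ × ℤ) (g : NN m) :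
    E12N q μ m n g = q ^ (-(n.1 * n.2)) • μ • DopLin m (-n) g -
      ∑ s ∈ nvars m g, ∑ r ∈ nvars m g,
        q ^ (n.2 * r.1 + s.2 * n.1 + s.2 * r.1) •
          XopLin m (n + s + r) (DopLin m s (DopLin m r g)) := rfl

theorem adXm_Xop (m k : ℤ × ℤ) : adXm m (Xop m k) = 0 := by
  funext g
  exact sub_eq_zero.mpr (XopLin_XmZLin m k 1 g).symm

theorem adXm_zero (m : ℤ × ℤ) : adXm m 0 = 0 := by
  funext g
  exact (sub_zero _).trans (map_zero (XmZLin m 1))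

theorem adXm_smul (m : ℤ × ℤ) (c : ℂ) (A : NN m → NN m) : adXm m (c • A) = c • adXm m A := by
  funext g
  change XmZLin m 1 (c • A g) - c • A (XmZ m 1 g) = c • (XmZLin m 1 (A g) - A (XmZ m 1 g))
  rw [map_smul, smul_sub]

theorem adXm_sub (m : ℤ × ℤ) (A B : NN m → NN m) : adXm m (A - B) = adXm m A - adXm m B := by
  funext g
  change XmZLin m 1 (A g - B g) - (A (XmZ m 1 g) - B (XmZ m 1 g)) =
    (XmZLin m 1 (A g) - A (XmZ m 1 g)) - (XmZLin m 1 (B g) - B (XmZ m 1 g))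
  rw [map_sub]
  abel

theorem adXm_E22N (q : ℂ) (m n : ℤ × ℤ) :
    adXm m (E22N q m n) = (-q ^ (m.1 * n.2)) • Xop m (n + m) := by
  funext g
  change XmZLin m 1 (E22N q m n g) - E22N q m n (XmZ m 1 g) =
    (-q ^ (m.1 * n.2)) • XopLin m (n + m) g
  rw [E22N_eq, E22N_eq, nvars_XmZ]
  change _ - ∑ s ∈ nvars m g, _ • XopLin m (n + s) (DopLin m s (XmZLin m 1 g)) = _
  simp only [DopLin_XmZLin_one, map_add, map_sum, map_smul, XopLin_XmZLin, smul_add,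
    Finset.sum_add_distrib, apply_ite (XopLin m _), map_zero, smul_ite, smul_zero,
    Finset.sum_ite_eq', mem_nvars_self, if_true]
  simp

theorem adXm_E11N (q μ : ℂ) (m n : ℤ × ℤ) :
    adXm m (E11N q μ m n) = q ^ (m.2 * n.1) • Xop m (n + m) := by
  funext g
  change XmZLin m 1 (E11N q μ m n g) - E11N q μ m n (XmZ m 1 g) =
    q ^ (m.2 * n.1) • XopLin m (n + m) g
  rw [E11N_eq, E11N_eq, nvars_XmZ]
  change _ - ((if n = 0 then μ • XmZLin m 1 g else 0) -
    ∑ s ∈ nvars m g, _ • XopLin m (n + s) (DopLin m s (XmZLin m 1 g))) = _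
  simp only [DopLin_XmZLin_one, map_sub, map_add, map_sum, map_smul, XopLin_XmZLin, smul_add,
    Finset.sum_add_distrib, apply_ite (XopLin m _), apply_ite (XmZLin m _), map_zero, smul_ite,
    smul_zero, Finset.sum_ite_eq', mem_nvars_self, if_true]
  abel

theorem DopLin_DopLin_XmZLin_one (m s r : ℤ × ℤ) (g : NN m) :
    DopLin m s (DopLin m r (XmZLin m 1 g)) = XmZLin m 1 (DopLin m s (DopLin m r g)) +
      ((if s = m then DopLin m r g else 0) + if r = m then DopLin m s g else 0) := by
  rw [DopLin_XmZLin_one, map_add, DopLin_XmZLin_one, apply_ite (DopLin m s), map_zero, add_assoc]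

theorem adXm_E12N (q μ : ℂ) (hq : q ≠ 0) (m n : ℤ × ℤ) :
    adXm m (E12N q μ m n) =
      q ^ (m.2 * n.1) • E22N q m (m + n) - q ^ (m.1 * n.2) • E11N q μ m (m + n) := by
  funext g
  change XmZLin m 1 (E12N q μ m n g) - E12N q μ m n (XmZ m 1 g) =
    q ^ (m.2 * n.1) • E22N q m (m + n) g - q ^ (m.1 * n.2) • E11N q μ m (m + n) g
  have hδ : q ^ (-(n.1 * n.2)) • μ • (if -n = m then g else 0) =
      q ^ (m.1 * n.2) • (if m + n = 0 then μ • g else 0) := by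
    by_cases h : m + n = 0
    · obtain rfl : -n = m := (eq_neg_of_add_eq_zero_left h).symm
      simp
    · have h' : -n ≠ m := fun e => h (by rw [← e, neg_add_cancel])
      simp [h, h']
  have h22 : ∑ r ∈ nvars m g, q ^ (n.2 * r.1 + m.2 * n.1 + m.2 * r.1) •
      XopLin m (n + m + r) (DopLin m r g) = q ^ (m.2 * n.1) • E22N q m (m + n) g := by
    rw [E22N_eq, Finset.smul_sum]
    refine Finset.sum_congr rfl fun r _ => ?_
    rw [smul_smul, ← zpow_add₀ hq, add_comm n m, Prod.snd_add]
    congr 2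
    ring
  have h11 : ∑ s ∈ nvars m g, q ^ (n.2 * m.1 + s.2 * n.1 + s.2 * m.1) •
      XopLin m (n + s + m) (DopLin m s g) = q ^ (m.1 * n.2) • (if m + n = 0 then μ • g else 0) -
        q ^ (m.1 * n.2) • E11N q μ m (m + n) g := by
    rw [E11N_eq, smul_sub, sub_sub_cancel, Finset.smul_sum]
    refine Finset.sum_congr rfl fun r _ => ?_
    rw [smul_smul, ← zpow_add₀ hq, add_right_comm n r m, add_comm n m, Prod.fst_add]
    congr 2
    ring
  rw [E12N_eq, E12N_eq, nvars_XmZ]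
  change _ - (_ • _ • DopLin m (-n) (XmZLin m 1 g) - ∑ s ∈ nvars m g, ∑ r ∈ nvars m g,
    _ • XopLin m (n + s + r) (DopLin m s (DopLin m r (XmZLin m 1 g)))) = _
  have hs : ∑ s ∈ nvars m g, ∑ r ∈ nvars m g, q ^ (n.2 * r.1 + s.2 * n.1 + s.2 * r.1) •
      XopLin m (n + s + r) (if s = m then DopLin m r g else 0) =
      q ^ (m.2 * n.1) • E22N q m (m + n) g := by
    rw [← h22, Finset.sum_eq_single_of_mem m (mem_nvars_self m g)]
    · simp
    · intro s _ hs
      simp [hs]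
  have hr : ∑ s ∈ nvars m g, ∑ r ∈ nvars m g, q ^ (n.2 * r.1 + s.2 * n.1 + s.2 * r.1) •
      XopLin m (n + s + r) (if r = m then DopLin m s g else 0) =
      q ^ (m.1 * n.2) • (if m + n = 0 then μ • g else 0) -
        q ^ (m.1 * n.2) • E11N q μ m (m + n) g := by
    rw [← h11]
    refine Finset.sum_congr rfl fun s _ => ?_
    rw [Finset.sum_eq_single_of_mem m (mem_nvars_self m g)]
    · simp
    · intro r _ hr
      simp [hr]
  simp only [DopLin_DopLin_XmZLin_one]
  simp only [DopLin_XmZLin_one, map_sub, map_add, map_sum, map_smul, XopLin_XmZLin, smul_add, Finset.sum_add_distrib, hs, hr, hδ]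
  abel

theorem adXm_adXm_E12N (q μ : ℂ) (hq : q ≠ 0) (m n : ℤ × ℤ) :
    adXm m (adXm m (E12N q μ m n)) =
      (-2 * q ^ (m.2 * n.1 + m.2 * m.1 + m.1 * n.2)) • Xop m (m + m + n) := by
  rw [adXm_E12N q μ hq, adXm_sub, adXm_smul, adXm_smul, adXm_E22N, adXm_E11N, smul_smul,
    smul_smul, mul_neg, ← zpow_add₀ hq, ← zpow_add₀ hq, Prod.fst_add, Prod.snd_add,
    add_right_comm m n m]
  funext g
  simp only [Pi.sub_apply, Pi.smul_apply]
  rw [← sub_smul]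
  congr 1
  ring_nf

theorem bchoose_zero (b : ℂ) : bchoose b 0 = 1 := by
  simp [bchoose]

theorem bchoose_one (b : ℂ) : bchoose b 1 = b := by
  simp [bchoose]

theorem bchoose_two (b : ℂ) : bchoose b 2 = b * (b - 1) / 2 := by
  simp [bchoose, Finset.prod_range_succ]

theorem adXm_iterate_of_le {m : ℤ × ℤ} {u : NN m → NN m} {k j : ℕ} (hkj : k ≤ j)
    (hu : (adXm m)^[k] u = 0) : (adXm m)^[j] u = 0 := by
  obtain ⟨i, rfl⟩ := Nat.exists_eq_add_of_le' hkj
  rw [Function.iterate_add_apply, hu]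
  exact Function.iterate_fixed (adXm_zero m) i

theorem Theta_eq_sum_range {m : ℤ × ℤ} {u : NN m → NN m} {k : ℕ} (b : ℂ)
    (hu : (adXm m)^[k] u = 0) :
    Theta m b u =
      ∑ j ∈ Finset.range k, bchoose b j • ((adXm m)^[j] u) ∘ (XmZ m (-1))^[j] := by
  refine finsum_eq_sum_of_support_subset _ fun j hj => ?_
  by_contra hjk
  have hkj : k ≤ j := by simpa using hjk
  refine hj ?_
  change bchoose b j • ((adXm m)^[j] u) ∘ (XmZ m (-1))^[j] = 0
  rw [adXm_iterate_of_le hkj hu]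
  exact smul_zero _

/-- `Θ_b(E21(n)) = E21(n)` and the formula for `Θ_b(E12(n))`. -/
theorem stmt4 (q μ : ℂ) (hq : q ≠ 0) (m : ℤ × ℤ) (b : ℂ) (n : ℤ × ℤ) :
    Theta m b (E21N m n) = E21N m n ∧
    Theta m b (E12N q μ m n) = fun g =>
      E12N q μ m n g
        + b • (q ^ (m.2 * n.1) • E22N q m (m + n) (XmZ m (-1) g)
               - q ^ (m.1 * n.2) • E11N q μ m (m + n) (XmZ m (-1) g))
        - (b * (b - 1) * q ^ (m.2 * n.1 + m.2 * m.1 + m.1 * n.2)) •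
            Xop m (m + m + n) (XmZ m (-1) (XmZ m (-1) g)) := by
  constructor
  · rw [Theta_eq_sum_range (k := 1) b (show (adXm m)^[1] (E21N m n) = 0 from adXm_Xop m n)]
    simp [bchoose_zero]
  · have h2 := adXm_adXm_E12N q μ hq m n
    have h3 : (adXm m)^[3] (E12N q μ m n) = 0 := by
      change adXm m (adXm m (adXm m _)) = 0
      rw [h2, adXm_smul, adXm_Xop, smul_zero]
    rw [Theta_eq_sum_range b h3]
    funext g
    rw [Finset.sum_range_succ, Finset.sum_range_succ, Finset.sum_range_one]
    change bchoose b 0 • E12N q μ m n g + bchoose b 1 • adXm m (E12N q μ m n) (XmZ m (-1) g) +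
      bchoose b 2 • adXm m (adXm m (E12N q μ m n)) (XmZ m (-1) (XmZ m (-1) g)) = _
    rw [h2, adXm_E12N q μ hq, bchoose_zero, bchoose_one, bchoose_two, one_smul,
      sub_eq_add_neg (_ + _), ← neg_smul, Pi.smul_apply, smul_smul]
    congr 2
    ring
end

section
/- Let v₀ = x_{n₁}^{i₁}⋯x_{n_k}^{i_k} be a monomial with n₁,…,n_k ∈ ℤ², all n_j ≠ m, and i₁,…,i_k ∈ ℕ. Then for every i ≥ 1, in N: E12(−m)(x_m^{−i} v₀) = −x_m^{−i}·𝓔_m(v₀) + (2(i₁+⋯+i_k) − μ − i − 1)·i·q^{−m₂m₁}·x_m^{−i−1} v₀. -/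
open MvPolynomial Finsupp

theorem Xop_self_single (m : ℤ × ℤ) (j : ℤ) (a : MvPolynomial (NVar m) ℂ) :
    Xop m m (single j a) = single (j + 1) a := by
  simp [Xop, XmZ, mapDomain_single]

theorem Xop_val_single {m : ℤ × ℤ} (s : NVar m) (j : ℤ) (a : MvPolynomial (NVar m) ℂ) :
    Xop m s.1 (single j a) = single j (X s * a) := by
  simp [Xop, s.2]

theorem Dop_self_single (m : ℤ × ℤ) (j : ℤ) (a : MvPolynomial (NVar m) ℂ) :
    Dop m m (single j a) = single (j - 1) (j • a) := by
  simp [Dop]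

theorem Dop_val_single {m : ℤ × ℤ} (s : NVar m) (j : ℤ) (a : MvPolynomial (NVar m) ℂ) :
    Dop m s.1 (single j a) = single j (pderiv s a) := by
  simp [Dop, s.2]

theorem Xop_zero (m k : ℤ × ℤ) : Xop m k 0 = 0 := by
  unfold Xop XmZ
  split_ifs <;> simp

/-- `x_m^j` commutes with multiplication by any variable. -/
theorem XmZ_Xop_single (m k : ℤ × ℤ) (j l : ℤ) (a : MvPolynomial (NVar m) ℂ) :
    XmZ m j (Xop m k (single l a)) = Xop m k (single (l + j) a) := by
  by_cases h : k = m
  · subst h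
    simp [Xop_self_single, XmZ, mapDomain_single, add_right_comm]
  · lift k to NVar m using h
    simp only [Xop_val_single, XmZ, mapDomain_single]

theorem XmZ_sum {ι : Type*} (m : ℤ × ℤ) (j : ℤ) (t : Finset ι) (f : ι → NN m) :
    XmZ m j (∑ s ∈ t, f s) = ∑ s ∈ t, XmZ m j (f s) :=
  mapDomain_finsetSum

theorem XmZ_smul (m : ℤ × ℤ) (j : ℤ) (c : ℂ) (g : NN m) :
    XmZ m j (c • g) = c • XmZ m j g :=
  mapDomain_smul c g

theorem sum_nvars_single {M : Type*} [AddCommMonoid M] (m : ℤ × ℤ) (j : ℤ)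
    (p : MvPolynomial (NVar m) ℂ) (f : ℤ × ℤ → M) :
    ∑ s ∈ nvars m (single j p), f s = f m + ∑ s ∈ p.vars, f s.1 := by
  have h : nvars m (single j p) = insert m (p.vars.image Subtype.val) := by
    by_cases hp : p = 0
    · simp [nvars, hp]
    · simp [nvars, Finsupp.support_single j hp]
  rw [h, Finset.sum_insert (by simp), Finset.sum_image Subtype.val_injective.injOn]

theorem EmN_single_zero (q : ℂ) (m : ℤ × ℤ) (p : MvPolynomial (NVar m) ℂ) :
    EmN q m (single 0 p) = ∑ s ∈ p.vars, ∑ r ∈ p.vars,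
      q ^ (-(m.2 * r.1.1) - s.1.2 * m.1 + s.1.2 * r.1.1) •
        Xop m (-m + s + r) (single 0 (pderiv s (pderiv r p))) := by
  rw [EmN, sum_nvars_single]
  simp only [sum_nvars_single, Dop_self_single, Dop_val_single, zero_smul, single_zero, Xop_zero,
    smul_zero, Finset.sum_const_zero, add_zero]
  simp [Dop, Xop_zero]

/-- Euler's identity for a monomial. -/
theorem sum_vars_X_mul_pderiv_monomial {σ : Type*} (d : σ →₀ ℕ) :
    ∑ s ∈ (monomial d (1 : ℂ)).vars, X s * pderiv s (monomial d (1 : ℂ)) =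
      (d.degree : ℂ) • monomial d 1 := by
  rw [vars_monomial one_ne_zero]
  simp only [X_mul_pderiv_monomial, ← Finset.sum_smul]
  rw [Nat.cast_smul_eq_nsmul, Finsupp.degree_apply]

/-- The action of `E12(-m)` on `x_m^j p`, for an eigenvector `p` of the Euler operator. -/
theorem E12N_neg_single (q μ : ℂ) (m : ℤ × ℤ) (j : ℤ)
    (p : MvPolynomial (NVar m) ℂ) (c : ℂ) (hp : ∑ s ∈ p.vars, X s * pderiv s p = c • p) :
    E12N q μ m (-m) (single j p) =
      -(XmZ m j (EmN q m (single 0 p))) +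
        ((μ - 2 * c - j + 1) * j * q ^ (-(m.2 * m.1))) • single (j - 1) p := by
  have hmm : ∀ r : ℤ × ℤ, -m + m + r = r := fun r => by simp
  have hsm : ∀ s : ℤ × ℤ, -m + s + m = s := fun s => by simp
  have e₁ : ∀ r : ℤ × ℤ, -m.2 * r.1 + m.2 * -m.1 + m.2 * r.1 = -(m.2 * m.1) := fun r => by ring
  have e₂ : ∀ s : ℤ × ℤ, -m.2 * m.1 + s.2 * -m.1 + s.2 * m.1 = -(m.2 * m.1) := fun s => by ring
  have hsum : ∑ s ∈ p.vars, (single (j - 1) (X s * (j • pderiv s p)) : NN m) =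
      ((j : ℂ) * c) • single (j - 1) p := by
    rw [← Finsupp.single_finsetSum]
    simp only [mul_smul_comm, ← Finset.smul_sum, hp]
    rw [← Int.cast_smul_eq_zsmul ℂ, smul_smul, smul_single]
  have hdiag : (single (j - 1 - 1 + 1) ((j - 1) • j • p) : NN m) =
      (((j : ℂ) - 1) * j) • single (j - 1) p := by
    rw [sub_add_cancel, smul_single, ← Int.cast_smul_eq_zsmul ℂ, ← Int.cast_smul_eq_zsmul ℂ,
      smul_smul]
    push_cast
    rfl
  rw [EmN_single_zero, E12N, sum_nvars_single]
  simp only [sum_nvars_single, Prod.fst_neg, Prod.snd_neg, neg_neg, Dop_self_single,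
    Dop_val_single, hmm, hsm, e₁, e₂, Xop_self_single, Xop_val_single, map_zsmul,
    Finset.sum_add_distrib, ← Finset.smul_sum, hsum, hdiag, XmZ_sum, XmZ_smul, XmZ_Xop_single,
    zero_add]
  have e₃ : ∀ s r : ℤ × ℤ, -m.2 * r.1 + s.2 * -m.1 + s.2 * r.1 =
      -(m.2 * r.1) - s.2 * m.1 + s.2 * r.1 := fun s r => by ring
  have e₄ : -(-m.1 * -m.2) = -(m.2 * m.1) := by ring
  have hj : (single (j - 1) (j • p) : NN m) = (j : ℂ) • single (j - 1) p := by
    rw [smul_single, Int.cast_smul_eq_zsmul]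
  simp only [e₃, e₄, hj]
  module

/-- the formula for `E12(−m)(x_m^{−i} v₀)` where
`v₀ = x_{n₁}^{i₁}⋯x_{n_K}^{i_K}` is a monomial in variables `≠ m` and `i ≥ 1`. -/
theorem stmt7 (q μ : ℂ) (hq : q ≠ 0) (m : ℤ × ℤ)
    (K : ℕ) (ns : Fin K → NVar m) (is : Fin K → ℕ) (i : ℕ) (hi : 1 ≤ i) :
    E12N q μ m (-m) (Finsupp.single (-(i : ℤ)) (∏ j, X (ns j) ^ is j)) =
      -(XmZ m (-(i : ℤ)) (EmN q m (Finsupp.single 0 (∏ j, X (ns j) ^ is j))))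
      + ((2 * (∑ j, (is j : ℂ)) - μ - (i : ℂ) - 1) * (i : ℂ) * q ^ (-(m.2 * m.1))) •
          Finsupp.single (-(i : ℤ) - 1) (∏ j, X (ns j) ^ is j) := by
  have hmon : (∏ j, X (ns j) ^ is j : MvPolynomial (NVar m) ℂ) =
      monomial (∑ j, single (ns j) (is j)) 1 := by
    simp [X_pow_eq_monomial, monomial_sum_one]
  have hdeg : ((∑ j, single (ns j) (is j)).degree : ℂ) = ∑ j, (is j : ℂ) := by
    simp [map_sum]
  rw [hmon, E12N_neg_single q μ m _ _ _ (sum_vars_X_mul_pderiv_monomial _), hdeg]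
  congr 2
  push_cast
  ring
end
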